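/- arXiv:2012.02751 — 6 statements merged into one kernel-verified Lean document; each statement's English description precedes it below -/
import Mathlib

section
/- Let κ be an uncountable cardinal and let 𝒰 be a free, κ-complete, normal ultrafilter on κ. If ⟨S_ξ : ξ < κ⟩ is any sequence of countable subsets of κ, then there exist a set S̄ ⊆ κ and a set U ∈ 𝒰 such that for all λ, μ ∈ U with λ < μ: S_λ ∩ λ = S̄ and S_λ ⊆ μ. -/
open Cardinal

open Filter

/-- A normal ultrafilter is closed under diagonal intersections. -/
theorem eventually_forall_lt_of_normal {α : Type*} [LinearOrder α] (𝒰 : Ultrafilter α)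
    (hnormal : ∀ U ∈ 𝒰, ∀ f : α → α, (∀ a ∈ U, (∃ b, b < a) → f a < a) →
      ∃ U₁ ∈ 𝒰, ∃ c : α, ∀ a ∈ U₁, f a = c)
    {p : α → α → Prop} (hp : ∀ x, ∀ᶠ a in (𝒰 : Filter α), p x a) :
    ∀ᶠ a in (𝒰 : Filter α), ∀ x < a, p x a := by
  by_contra hcon
  rw [← Ultrafilter.eventually_not] at hcon
  have hex : ∀ a, ∃ x, (¬ ∀ x < a, p x a) → x < a ∧ ¬ p x a := by
    intro a
    by_cases h : ∀ x < a, p x a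
    · exact ⟨a, fun h' => absurd h h'⟩
    · push Not at h
      obtain ⟨x, hx⟩ := h
      exact ⟨x, fun _ => hx⟩
  choose f hf using hex
  obtain ⟨U₁, hU₁, c, hc⟩ := hnormal _ hcon f fun a ha _ => (hf a ha).1
  have hU₁' : ∀ᶠ a in (𝒰 : Filter α), f a = c := mem_of_superset hU₁ hc
  obtain ⟨a, ha, hfa, hpa⟩ := (hcon.and (hU₁'.and (hp c))).exists
  exact (hf a ha).2 (hfa ▸ hpa)

/-- An ultrafilter on `α` that is closed under intersections of fewer than `#α` members has the
countable intersection property when `α` is uncountable. -/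
theorem countableInterFilter_of_complete {α : Type} (hunc : ℵ₀ < #α) (𝒰 : Ultrafilter α)
    (hcomplete : ∀ (ι : Type) (f : ι → Set α), #ι < #α → (∀ i, f i ∈ 𝒰) →
      (⋂ i, f i) ∈ 𝒰) : CountableInterFilter (𝒰 : Filter α) where
  countable_sInter_mem T hT hmem := by
    rw [Set.sInter_eq_iInter]
    exact hcomplete T (fun i => i) ((Cardinal.le_aleph0_iff_set_countable.2 hT).trans_lt hunc)
      fun i => hmem i i.2

/-- A free complete ultrafilter on an initial ordinal contains every final segment. -/
theorem eventually_gt_of_complete {α : Type} [LinearOrder α]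
    (hinit : ∀ a : α, #(Set.Iio a) < #α) (𝒰 : Ultrafilter α)
    (hfree : ∀ s : Set α, s.Finite → s ∉ 𝒰)
    (hcomplete : ∀ (ι : Type) (f : ι → Set α), #ι < #α → (∀ i, f i ∈ 𝒰) →
      (⋂ i, f i) ∈ 𝒰) (x : α) : ∀ᶠ a in (𝒰 : Filter α), x < a := by
  have hne (y : α) : ({y}ᶜ : Set α) ∈ 𝒰 :=
    Ultrafilter.compl_mem_iff_notMem.2 (hfree _ (Set.finite_singleton y))
  have hall := hcomplete (Set.Iio x) (fun y => {y.1}ᶜ) (hinit x) fun y => hne y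
  filter_upwards [hall, hne x] with a ha hax
  simp only [Set.mem_iInter, Set.mem_compl_iff, Set.mem_singleton_iff] at ha hax
  exact lt_of_le_of_ne (not_lt.1 fun h => ha ⟨a, h⟩ rfl) (Ne.symm hax)

/-- A countable-set-valued map that is regressive along a normal, countably complete ultrafilter
is eventually constant. -/
theorem exists_eventually_eq_of_normal {α : Type*} [LinearOrder α] (𝒰 : Ultrafilter α)
    [CountableInterFilter (𝒰 : Filter α)]
    (hnormal : ∀ U ∈ 𝒰, ∀ f : α → α, (∀ a ∈ U, (∃ b, b < a) → f a < a) →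
      ∃ U₁ ∈ 𝒰, ∃ c : α, ∀ a ∈ U₁, f a = c)
    {T : α → Set α} (hT : ∀ a, (T a).Countable) (hlt : ∀ a, ∀ x ∈ T a, x < a) :
    ∃ B : Set α, ∀ᶠ a in (𝒰 : Filter α), T a = B := by
  by_cases hne : ∀ᶠ a in (𝒰 : Filter α), (T a).Nonempty
  · have hex : ∀ a, ∃ e : ℕ → α, (T a).Nonempty → T a = Set.range e := by
      intro a
      by_cases h : (T a).Nonempty
      · obtain ⟨e, he⟩ := (hT a).exists_eq_range h
        exact ⟨e, fun _ => he⟩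
      · exact ⟨fun _ => a, fun h' => absurd h' h⟩
    choose e he using hex
    have hconst : ∀ n, ∃ c, ∀ᶠ a in (𝒰 : Filter α), e a n = c := by
      intro n
      obtain ⟨U₁, hU₁, c, hc⟩ := hnormal _ hne (fun a => e a n) fun a ha _ =>
        hlt a _ (he a ha ▸ Set.mem_range_self n)
      exact ⟨c, mem_of_superset hU₁ hc⟩
    choose c hc using hconst
    refine ⟨Set.range c, ?_⟩
    filter_upwards [hne, eventually_countable_forall.2 hc] with a ha hca
    rw [he a ha, funext hca]
  · refine ⟨∅, ?_⟩
    filter_upwards [Ultrafilter.eventually_not.2 hne] with a ha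
    exact Set.not_nonempty_iff_eq_empty.1 ha

/-- the pressing-down claim for a free, `κ`-complete, normal ultrafilter on
an uncountable cardinal `κ`.  The cardinal `κ` (viewed as the set of ordinals below `κ`)
is represented by a well-ordered type `α` of cardinality `κ` in which every proper
initial segment has cardinality `< κ` (so the order type of `α` is the initial ordinal
of `κ`). -/
theorem stmt5 {α : Type} [LinearOrder α] [WellFoundedLT α]
    -- `α` has the order type of the initial ordinal of the cardinal `κ = #α`:
    (hinit : ∀ a : α, #(Set.Iio a) < #α)
    -- `κ` is uncountable:
    (hunc : ℵ₀ < #α)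
    (𝒰 : Ultrafilter α)
    -- `𝒰` is free: it contains no finite set
    (hfree : ∀ s : Set α, s.Finite → s ∉ 𝒰)
    -- `𝒰` is `κ`-complete: the intersection of fewer than `κ` members of `𝒰` is in `𝒰`
    (hcomplete : ∀ (ι : Type) (f : ι → Set α), #ι < #α → (∀ i, f i ∈ 𝒰) →
      (⋂ i, f i) ∈ 𝒰)
    -- `𝒰` is normal: every function regressive on a member of `𝒰` is constant on a member
    (hnormal : ∀ U ∈ 𝒰, ∀ f : α → α, (∀ a ∈ U, (∃ b, b < a) → f a < a) →
      ∃ U₁ ∈ 𝒰, ∃ c : α, ∀ a ∈ U₁, f a = c)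
    -- a sequence of countable subsets of `κ`
    (S : α → Set α) (hS : ∀ ξ, (S ξ).Countable) :
    ∃ (Sbar : Set α) (U : Set α), U ∈ 𝒰 ∧
      ∀ lam ∈ U, ∀ mu ∈ U, lam < mu →
        {x ∈ S lam | x < lam} = Sbar ∧ ∀ x ∈ S lam, x < mu := by
  have := countableInterFilter_of_complete hunc 𝒰 hcomplete
  obtain ⟨B, hB⟩ := exists_eventually_eq_of_normal 𝒰 hnormal
    (T := fun a => {x ∈ S a | x < a}) (fun a => (hS a).mono fun _ hx => hx.1)
    fun _ _ hx => hx.2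
  have hbound : ∀ᶠ m in (𝒰 : Filter α), ∀ l < m, ∀ x ∈ S l, x < m :=
    eventually_forall_lt_of_normal 𝒰 hnormal fun l =>
      (eventually_countable_ball (hS l)).2 fun x _ =>
        eventually_gt_of_complete hinit 𝒰 hfree hcomplete x
  exact ⟨B, _, hB.and hbound, fun l hl m hm hlm => ⟨hl.1, hm.2 l hlm⟩⟩
end

section
/- Let κ be an uncountable cardinal and let 𝒰 be a free, κ-complete, normal ultrafilter on κ. Then there is a set U ∈ 𝒰 such that every α ∈ U is an uncountable regular limit cardinal (i.e., the set of ordinals below κ that are weakly inaccessible cardinals belongs to 𝒰). -/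
open Cardinal

/-- Every function from a proper initial segment of `Set.Iio a` to `Set.Iio a` is strictly
bounded below `a`. -/
def BoundsShortFamilies {α : Type} [LinearOrder α] (a : α) : Prop :=
  ∀ b < a, ∀ g : α → α, (∀ x < b, g x < a) → ∃ c < a, ∀ x < b, g x < c

section WellOrder

variable {α : Type} [LinearOrder α] [WellFoundedLT α]

theorem card_typein_lt_eq_mk_Iio (a : α) :
    (Ordinal.typein ((· < ·) : α → α → Prop) a).card = #(Set.Iio a) :=
  (Ordinal.card_typein a).symm

theorem ord_mk_Iio_le_typein (a : α) :
    (#(Set.Iio a)).ord ≤ Ordinal.typein ((· < ·) : α → α → Prop) a := by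
  rw [Cardinal.ord_le, card_typein_lt_eq_mk_Iio]

theorem exists_lt_typein_eq {a : α} {o : Ordinal}
    (ho : o < Ordinal.typein ((· < ·) : α → α → Prop) a) :
    ∃ b < a, Ordinal.typein ((· < ·) : α → α → Prop) b = o := by
  obtain ⟨b, rfl⟩ := Ordinal.typein_surj ((· < ·) : α → α → Prop)
    (ho.trans (Ordinal.typein_lt_type _ a))
  exact ⟨b, (Ordinal.typein_lt_typein _).1 ho, rfl⟩

namespace BoundsShortFamilies

theorem exists_bound {a : α} (ha : BoundsShortFamilies a) {s : Set α} (hs : s ⊆ Set.Iio a)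
    (hcard : (#s).ord < Ordinal.typein ((· < ·) : α → α → Prop) a) :
    ∃ c < a, ∀ x ∈ s, x < c := by
  classical
  obtain ⟨b, hb, hbs⟩ := exists_lt_typein_eq hcard
  have hmk : #(Set.Iio b) = #s := by
    rw [← card_typein_lt_eq_mk_Iio, hbs, Cardinal.card_ord]
  obtain ⟨e⟩ := Cardinal.eq.1 hmk
  obtain ⟨c, hc, hbound⟩ := ha b hb
    (fun x => if hx : x ∈ Set.Iio b then (e ⟨x, hx⟩ : α) else a) (fun x hx => by
      rw [dif_pos (Set.mem_Iio.2 hx)]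
      exact hs (e ⟨x, hx⟩).2)
  refine ⟨c, hc, fun y hy => ?_⟩
  obtain ⟨x, hx⟩ := e.surjective ⟨y, hy⟩
  have h := hbound x x.2
  rwa [dif_pos x.2, Subtype.coe_eta, hx] at h

theorem typein_eq_ord {a : α} (ha : BoundsShortFamilies a) :
    Ordinal.typein ((· < ·) : α → α → Prop) a = (#(Set.Iio a)).ord := by
  refine ((ord_mk_Iio_le_typein a).eq_of_not_lt fun hlt => ?_).symm
  obtain ⟨c, hc, hbound⟩ := ha.exists_bound subset_rfl hlt
  exact (hbound c hc).false

theorem isRegular {a : α} (ha : BoundsShortFamilies a) (hinf : ℵ₀ ≤ #(Set.Iio a)) :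
    (#(Set.Iio a)).IsRegular := by
  refine ⟨hinf, ?_⟩
  rw [← ha.typein_eq_ord, ← Order.cof_Iio, Order.le_cof_iff]
  intro s hs
  by_contra! hlt
  have himage : #(Subtype.val '' s : Set α) = #s := Cardinal.mk_image_eq Subtype.val_injective
  obtain ⟨c, hc, hbound⟩ := ha.exists_bound (s := Subtype.val '' s)
    (by rintro _ ⟨x, -, rfl⟩; exact x.2)
    (by rw [himage, ha.typein_eq_ord]; exact Cardinal.ord_lt_ord.2 hlt)
  obtain ⟨y, hy, hcy⟩ := hs ⟨c, hc⟩
  exact (hbound y ⟨y, hy, rfl⟩).not_ge hcy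

end BoundsShortFamilies

end WellOrder

section NormalUltrafilter

variable {α : Type} {𝒰 : Ultrafilter α}

theorem eventually_notMem_of_mk_lt (hfree : ∀ s : Set α, s.Finite → s ∉ 𝒰)
    (hcomplete : ∀ (ι : Type) (f : ι → Set α), #ι < #α → (∀ i, f i ∈ 𝒰) → (⋂ i, f i) ∈ 𝒰)
    {s : Set α} (hs : #s < #α) : ∀ᶠ a in (𝒰 : Filter α), a ∉ s := by
  filter_upwards [hcomplete s (fun x => {x.1}ᶜ) hs fun x =>
    Ultrafilter.compl_mem_iff_notMem.2 (hfree _ (Set.finite_singleton _))] with a ha has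
  exact Set.mem_iInter.1 ha ⟨a, has⟩ rfl

variable [LinearOrder α]

theorem exists_eventually_eq_of_eventually_lt
    (hnormal : ∀ U ∈ 𝒰, ∀ f : α → α, (∀ a ∈ U, (∃ b, b < a) → f a < a) →
      ∃ U₁ ∈ 𝒰, ∃ c : α, ∀ a ∈ U₁, f a = c)
    {f : α → α} (hf : ∀ᶠ a in (𝒰 : Filter α), f a < a) :
    ∃ c, ∀ᶠ a in (𝒰 : Filter α), f a = c := by
  obtain ⟨U, hU, c, hc⟩ := hnormal _ hf f fun a ha _ => ha
  exact ⟨c, Filter.mem_of_superset hU hc⟩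

theorem eventually_boundsShortFamilies
    (hinit : ∀ a : α, #(Set.Iio a) < #α)
    (hcomplete : ∀ (ι : Type) (f : ι → Set α), #ι < #α → (∀ i, f i ∈ 𝒰) → (⋂ i, f i) ∈ 𝒰)
    (hpress : ∀ f : α → α, (∀ᶠ a in (𝒰 : Filter α), f a < a) →
      ∃ c, ∀ᶠ a in (𝒰 : Filter α), f a = c)
    (htail : ∀ b : α, ∀ᶠ a in (𝒰 : Filter α), b < a) :
    ∀ᶠ a in (𝒰 : Filter α), BoundsShortFamilies a := by
  by_contra hcon
  have hbad : ∀ᶠ a in (𝒰 : Filter α), ¬ BoundsShortFamilies a := Ultrafilter.eventually_not.2 hcon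
  have hex : ∀ a : α, ∃ (b : α) (g : α → α), ¬ BoundsShortFamilies a →
      b < a ∧ (∀ x < b, g x < a) ∧ ∀ c < a, ∃ x < b, c ≤ g x := by
    intro a
    by_cases ha : BoundsShortFamilies a
    · exact ⟨a, id, fun h => (h ha).elim⟩
    · have h := ha
      unfold BoundsShortFamilies at h
      push Not at h
      obtain ⟨b, hb, g, hg, hunb⟩ := h
      exact ⟨b, g, fun _ => ⟨hb, hg, hunb⟩⟩
  choose b g hbg using hex
  obtain ⟨b₀, hb₀⟩ := hpress b (hbad.mono fun a ha => (hbg a ha).1)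
  have hfibre : ∀ x : Set.Iio b₀, ∃ c, ∀ᶠ a in (𝒰 : Filter α), g a x = c := fun x =>
    hpress (fun a => g a x) (by
      filter_upwards [hbad, hb₀] with a ha hba
      exact (hbg a ha).2.1 x (hba ▸ x.2))
  choose h hh using hfibre
  have hgood : ∀ᶠ a in (𝒰 : Filter α), ¬ BoundsShortFamilies a ∧ b a = b₀ ∧
      ∀ x : Set.Iio b₀, g a x = h x := by
    filter_upwards [hbad, hb₀, hcomplete _ _ (hinit b₀) hh] with a h₁ h₂ h₃
    exact ⟨h₁, h₂, fun x => Set.mem_iInter.1 h₃ x⟩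
  obtain ⟨a, ha, hab, hah⟩ := hgood.exists
  obtain ⟨a', ⟨ha', hab', hah'⟩, hlt⟩ := (hgood.and (htail a)).exists
  obtain ⟨x, hx, hax⟩ := (hbg a' ha').2.2 a hlt
  rw [hab'] at hx
  have hga : g a x < a := (hbg a ha).2.1 x (hab.symm ▸ hx)
  rw [hah' ⟨x, hx⟩, ← hah ⟨x, hx⟩] at hax
  exact hga.not_ge hax

theorem eventually_succ_lt_mk_Iio [WellFoundedLT α]
    (hpress : ∀ f : α → α, (∀ᶠ a in (𝒰 : Filter α), f a < a) →
      ∃ c, ∀ᶠ a in (𝒰 : Filter α), f a = c)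
    (htail : ∀ b : α, ∀ᶠ a in (𝒰 : Filter α), b < a)
    (hord : ∀ᶠ a in (𝒰 : Filter α),
      Ordinal.typein ((· < ·) : α → α → Prop) a = (#(Set.Iio a)).ord) :
    ∀ᶠ a in (𝒰 : Filter α),
      ∀ d : Cardinal, d < #(Set.Iio a) → Order.succ d < #(Set.Iio a) := by
  by_contra hcon
  have hbad := Ultrafilter.eventually_not.2 hcon
  have hex : ∀ a : α, ∃ b : α,
      (¬ ∀ d : Cardinal, d < #(Set.Iio a) → Order.succ d < #(Set.Iio a)) →
        b < a ∧ #(Set.Iio a) = Order.succ #(Set.Iio b) := by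
    intro a
    by_cases ha : ∀ d : Cardinal, d < #(Set.Iio a) → Order.succ d < #(Set.Iio a)
    · exact ⟨a, fun h => (h ha).elim⟩
    · have h := ha
      push Not at h
      obtain ⟨d, hd, hle⟩ := h
      obtain ⟨b, hb, hbd⟩ := exists_lt_typein_eq
        ((Cardinal.ord_lt_ord.2 hd).trans_le (ord_mk_Iio_le_typein a))
      refine ⟨b, fun _ => ⟨hb, ?_⟩⟩
      rw [← card_typein_lt_eq_mk_Iio b, hbd, Cardinal.card_ord]
      exact hle.antisymm (Order.succ_le_of_lt hd)
  choose b hb using hex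
  obtain ⟨b₀, hb₀⟩ := hpress b (hbad.mono fun a ha => (hb a ha).1)
  have hconst : ∀ᶠ a in (𝒰 : Filter α), Ordinal.typein ((· < ·) : α → α → Prop) a =
      (Order.succ #(Set.Iio b₀)).ord := by
    filter_upwards [hbad, hb₀, hord] with a h₁ h₂ h₃
    rw [h₃, (hb a h₁).2, h₂]
  obtain ⟨a, ha⟩ := hconst.exists
  obtain ⟨a', ha', hlt⟩ := (hconst.and (htail a)).exists
  exact hlt.ne (Ordinal.typein_injective _ (ha.trans ha'.symm))

theorem eventually_omega0_lt_typein [WellFoundedLT α] (hunc : ℵ₀ < #α)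
    (hsmall : ∀ s : Set α, #s < #α → ∀ᶠ a in (𝒰 : Filter α), a ∉ s) :
    ∀ᶠ a in (𝒰 : Filter α),
      Ordinal.omega0 < Ordinal.typein ((· < ·) : α → α → Prop) a := by
  have hcount :
      {a : α | Ordinal.typein ((· < ·) : α → α → Prop) a ≤ Ordinal.omega0}.Countable := by
    refine Set.Countable.preimage_of_injOn (s := Set.Iic Ordinal.omega0) ?_
      (Ordinal.typein_injective _).injOn
    rw [← Set.Iio_insert, Set.countable_insert, ← Cardinal.le_aleph0_iff_set_countable,
      Cardinal.mk_Iio_ordinal]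
    simp
  filter_upwards [hsmall _ (hcount.le_aleph0.trans_lt hunc)] with a ha
  exact not_le.1 ha

end NormalUltrafilter

/-- a free, `κ`-complete, normal ultrafilter on an uncountable cardinal `κ`
contains the set of ordinals below `κ` that are weakly inaccessible cardinals (i.e.
uncountable regular limit cardinals).  The cardinal `κ` (viewed as the set of ordinals
below `κ`) is represented by a well-ordered type `α` of cardinality `κ` in which every
proper initial segment has cardinality `< κ`; the ordinal corresponding to `a : α` is
`Ordinal.typein (· < ·) a`. -/
theorem stmt6 {α : Type} [LinearOrder α] [WellFoundedLT α]
    (hinit : ∀ a : α, #(Set.Iio a) < #α)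
    (hunc : ℵ₀ < #α)
    (𝒰 : Ultrafilter α)
    -- `𝒰` is free: it contains no finite set
    (hfree : ∀ s : Set α, s.Finite → s ∉ 𝒰)
    -- `𝒰` is `κ`-complete
    (hcomplete : ∀ (ι : Type) (f : ι → Set α), #ι < #α → (∀ i, f i ∈ 𝒰) →
      (⋂ i, f i) ∈ 𝒰)
    -- `𝒰` is normal
    (hnormal : ∀ U ∈ 𝒰, ∀ f : α → α, (∀ a ∈ U, (∃ b, b < a) → f a < a) →
      ∃ U₁ ∈ 𝒰, ∃ c : α, ∀ a ∈ U₁, f a = c) :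
    ∃ U ∈ 𝒰, ∀ a ∈ U,
      -- the ordinal corresponding to `a` is a cardinal (an initial ordinal) ...
      Ordinal.typein ((· < ·) : α → α → Prop) a = (#(Set.Iio a)).ord ∧
      -- ... which is uncountable,
      ℵ₀ < #(Set.Iio a) ∧
      -- regular,
      (#(Set.Iio a)).IsRegular ∧
      -- and a limit cardinal
      (∀ d : Cardinal, d < #(Set.Iio a) → Order.succ d < #(Set.Iio a)) := by
  have hsmall : ∀ s : Set α, #s < #α → ∀ᶠ a in (𝒰 : Filter α), a ∉ s :=
    fun s hs => eventually_notMem_of_mk_lt hfree hcomplete hs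
  have htail : ∀ b : α, ∀ᶠ a in (𝒰 : Filter α), b < a := fun b => by
    filter_upwards [hsmall _ (hinit b),
      hsmall {b} (by simpa using Cardinal.one_lt_aleph0.trans hunc)]
      with a h₁ h₂
    exact lt_of_le_of_ne (not_lt.1 h₁) (Ne.symm h₂)
  have hpress : ∀ f : α → α, (∀ᶠ a in (𝒰 : Filter α), f a < a) →
      ∃ c, ∀ᶠ a in (𝒰 : Filter α), f a = c :=
    fun _ => exists_eventually_eq_of_eventually_lt hnormal
  have hreg := eventually_boundsShortFamilies hinit hcomplete hpress htail
  have hlim := eventually_succ_lt_mk_Iio hpress htail (hreg.mono fun _ ha => ha.typein_eq_ord)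
  refine ⟨_, (hreg.and hlim).and (eventually_omega0_lt_typein hunc hsmall), ?_⟩
  rintro a ⟨⟨ha, hsucc⟩, hω⟩
  have hunca : ℵ₀ < #(Set.Iio a) := by
    rwa [ha.typein_eq_ord, ← Cardinal.ord_aleph0, Cardinal.ord_lt_ord] at hω
  exact ⟨ha.typein_eq_ord, hunca, ha.isRegular hunca.le, hsucc⟩
end

section
/- Every separable Hausdorff sequential topological space has cardinality at most 𝔠. -/
open Cardinal

/-- The arities of the operations used to iterate sequential limits from a countable set:
one operation of arity `ℕ` (take the limit), and countably many constants. -/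
def SeqLimArity : Option ℕ → Type
  | none => ℕ
  | some _ => Empty

theorem mk_wType_seqLimArity_le : #(WType SeqLimArity) ≤ 𝔠 := by
  apply WType.cardinalMk_le_of_le
  have h : ∀ a, 𝔠 ^ #(SeqLimArity a) ≤ 𝔠 := by
    rintro (_ | n)
    · change 𝔠 ^ #ℕ ≤ 𝔠
      simp
    · change 𝔠 ^ #Empty ≤ 𝔠
      simpa using nat_lt_continuum 1 |>.le
  calc Cardinal.sum (fun a => 𝔠 ^ #(SeqLimArity a))
      ≤ Cardinal.sum (fun _ : Option ℕ => 𝔠) := Cardinal.sum_le_sum _ _ h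
    _ = ℵ₀ * 𝔠 := by simp [Cardinal.sum_const]
    _ = 𝔠 := by simp

/-- Evaluate a well-founded tree of iterated sequential limits, with constants given by `d`. -/
noncomputable def seqLimEval {X : Type*} [TopologicalSpace X] [Nonempty X] (d : ℕ → X) :
    WType SeqLimArity → X
  | ⟨none, f⟩ => Filter.limUnder Filter.atTop fun n : ℕ => seqLimEval d (f n)
  | ⟨some n, _⟩ => d n

theorem isSeqClosed_range_seqLimEval {X : Type*} [TopologicalSpace X] [T2Space X] [Nonempty X]
    (d : ℕ → X) : IsSeqClosed (Set.range (seqLimEval d)) := by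
  intro u x hu hx
  choose f hf using hu
  refine ⟨⟨none, f⟩, (seqLimEval.eq_1 d f).trans ?_⟩
  simp only [hf]
  exact hx.limUnder_eq

theorem range_subset_range_seqLimEval {X : Type*} [TopologicalSpace X] [Nonempty X]
    (d : ℕ → X) : Set.range d ⊆ Set.range (seqLimEval d) := by
  rintro _ ⟨n, rfl⟩
  exact ⟨⟨some n, Empty.elim⟩, seqLimEval.eq_2 d n _⟩

/-- Every separable Hausdorff sequential space has cardinality at most `𝔠`. -/
theorem stmt11 {X : Type u} [TopologicalSpace X] [T2Space X]
    [TopologicalSpace.SeparableSpace X] [SequentialSpace X] :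
    #X ≤ Cardinal.continuum := by
  cases isEmpty_or_nonempty X
  · simp
  let d := TopologicalSpace.denseSeq X
  have hdense : Dense (Set.range (seqLimEval d)) :=
    (TopologicalSpace.denseRange_denseSeq X).mono (range_subset_range_seqLimEval d)
  have hsurj : Function.Surjective (seqLimEval d) := by
    rw [← Set.range_eq_univ, ← (isSeqClosed_range_seqLimEval d).isClosed.closure_eq]
    exact hdense.closure_eq
  have h := Cardinal.mk_le_of_surjective (hsurj.comp (ULift.down_surjective : Function.Surjective (ULift.down : ULift.{u} (WType SeqLimArity) → _)))
  rw [Cardinal.mk_uLift] at h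
  exact h.trans (by simpa using mk_wType_seqLimArity_le)
end

section
/- Let X be a Tychonoff (completely regular Hausdorff) topological space, let x ∈ X, and let {U_n : n ∈ ω} be a countable local base at x in X consisting of cozero sets (each U_n is of the form f⁻¹(ℝ \ {0}) for some continuous f : X → ℝ). Then, identifying X with its image in the Stone–Čech compactification βX, the family { βX \ cl_{βX}(X \ U_n) : n ∈ ω } is a local base at x in βX; in particular, x has countable character in βX. -/
open Filter

open Topology in
/-- Under an inducing map, the complement of the closure of the image of the complement of a
neighborhood of `x` is a neighborhood of the image of `x`. -/
theorem Topology.IsInducing.compl_closure_image_compl_mem_nhds {X Y : Type*} [TopologicalSpace X]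
    [TopologicalSpace Y] {i : X → Y} (hi : IsInducing i) {x : X} {U : Set X} (hU : U ∈ 𝓝 x) :
    (closure (i '' Uᶜ))ᶜ ∈ 𝓝 (i x) := by
  refine isClosed_closure.isOpen_compl.mem_nhds fun hx => ?_
  have hx' : x ∈ closure Uᶜ := by rwa [hi.closure_eq_preimage_closure_image]
  rw [closure_compl] at hx'
  exact hx' (mem_interior_iff_mem_nhds.2 hU)

/-- For a map with dense range, the complement of the closure of the image of `Uᶜ` is contained in
the closure of the image of `U`. -/
theorem DenseRange.compl_closure_image_compl_subset {X Y : Type*} [TopologicalSpace Y] {i : X → Y}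
    (hi : DenseRange i) (U : Set X) : (closure (i '' Uᶜ))ᶜ ⊆ closure (i '' U) := by
  rw [Set.compl_subset_iff_union, ← closure_union, ← Set.image_union, Set.compl_union_self,
    Set.image_univ, hi.closure_range]

/-- if `x` has a countable local base `{Uₙ}` of cozero sets in a Tychonoff
space `X`, then the sets `βX \ cl_{βX}(X \ Uₙ)` form a local base at (the image of) `x`
in the Stone–Čech compactification `βX`; in particular `x` has countable character in
`βX`. -/
theorem stmt12 {X : Type u} [TopologicalSpace X] [T35Space X]
    (x : X) (U : ℕ → Set X)
    -- each `Uₙ` is a neighborhood of `x` ...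
    (hnbhd : ∀ n, U n ∈ nhds x)
    -- ... every neighborhood of `x` contains some `Uₙ` ...
    (hbase : ∀ V ∈ nhds x, ∃ n, U n ⊆ V)
    -- ... and each `Uₙ` is a cozero set
    (hcoz : ∀ n, ∃ f : X → ℝ, Continuous f ∧ U n = {y : X | f y ≠ 0}) :
    (∀ n, (closure (stoneCechUnit '' (U n)ᶜ))ᶜ ∈ nhds (stoneCechUnit x)) ∧
    (∀ W ∈ nhds (stoneCechUnit x), ∃ n, (closure (stoneCechUnit '' (U n)ᶜ))ᶜ ⊆ W) ∧
    (nhds (stoneCechUnit x)).IsCountablyGenerated := by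
  have hmem n := isInducing_stoneCechUnit.compl_closure_image_compl_mem_nhds (hnbhd n)
  have hsub : ∀ W ∈ nhds (stoneCechUnit x),
      ∃ n, (closure (stoneCechUnit '' (U n)ᶜ))ᶜ ⊆ W := by
    intro W hW
    obtain ⟨K, hK, hKc, hKW⟩ := exists_mem_nhds_isClosed_subset hW
    obtain ⟨n, hn⟩ := hbase _ (continuous_stoneCechUnit.continuousAt.preimage_mem_nhds hK)
    exact ⟨n, (denseRange_stoneCechUnit.compl_closure_image_compl_subset (U n)).trans
      ((closure_minimal (Set.image_subset_iff.2 hn) hKc).trans hKW)⟩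
  refine ⟨hmem, hsub, ?_⟩
  have hb : (nhds (stoneCechUnit x)).HasBasis (fun _ : ℕ => True)
      fun n => (closure (stoneCechUnit '' (U n)ᶜ))ᶜ :=
    ⟨fun W => ⟨fun hW => (hsub W hW).imp fun _ h => ⟨trivial, h⟩,
      fun ⟨n, _, h⟩ => Filter.mem_of_superset (hmem n) h⟩⟩
  exact HasCountableBasis.isCountablyGenerated ⟨hb, Set.to_countable _⟩
end

section
/- Let X be a Tychonoff (completely regular Hausdorff) topological space that is first countable and sequentially compact, and suppose that the remainder βX \ X of the Stone–Čech compactification contains no infinite compact subsets. Then βX is sequentially compact. -/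
open Filter Topology Set

/-- The image of a point with a countable neighbourhood base under a dense inducing map into a
`T3` space again has a countable neighbourhood base. -/
theorem IsDenseInducing.isCountablyGenerated_nhds {X Y : Type*} [TopologicalSpace X]
    [TopologicalSpace Y] [T3Space Y] {i : X → Y} (hi : IsDenseInducing i) (x : X)
    [(𝓝 x).IsCountablyGenerated] : (𝓝 (i x)).IsCountablyGenerated := by
  obtain ⟨B, hB⟩ := (𝓝 x).exists_antitone_basis
  exact (hB.toHasBasis.hasBasis_of_isDenseInducing hi).isCountablyGenerated

/-- In a `T1` space, a point in the closure of the range of a sequence which is not a term of the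
sequence is a cluster point of the sequence. -/
theorem mapClusterPt_of_mem_closure_range_of_notMem {Y : Type*} [TopologicalSpace Y] [T1Space Y]
    {u : ℕ → Y} {y : Y} (hy : y ∈ closure (range u)) (hyu : y ∉ range u) :
    MapClusterPt y atTop u := by
  rw [mapClusterPt_iff_frequently]
  intro s hs
  rw [frequently_atTop]
  intro N
  have hF : (u '' Iio N)ᶜ ∈ 𝓝 y :=
    ((finite_Iio N).image u).isClosed.isOpen_compl.mem_nhds
      fun h => hyu (image_subset_range u _ h)
  obtain ⟨_, ⟨hzs, hzF⟩, n, rfl⟩ := mem_closure_iff_nhds.1 hy _ (inter_mem hs hF)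
  exact ⟨n, not_lt.1 fun hn => hzF (mem_image_of_mem u hn), hzs⟩

/-- A sequence in a finite set has a constant subsequence. -/
theorem Set.Finite.exists_strictMono_const {Y : Type*} {K : Set Y} (hK : K.Finite) {u : ℕ → Y}
    (hu : ∀ n, u n ∈ K) : ∃ y, ∃ φ : ℕ → ℕ, StrictMono φ ∧ ∀ n, u (φ n) = y := by
  have : Finite K := hK
  obtain ⟨y, hy⟩ := Finite.exists_infinite_fiber fun n => (⟨u n, hu n⟩ : K)
  obtain ⟨φ, hφ, h⟩ := extraction_of_frequently_atTop
    (Nat.frequently_atTop_iff_infinite.2 (infinite_coe_iff.1 hy))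
  exact ⟨y, φ, hφ, fun n => congrArg Subtype.val (h n)⟩

/-- if `X` is a Tychonoff, first countable, sequentially compact space
whose Stone–Čech remainder `βX \ X` contains no infinite compact subsets, then `βX`
is sequentially compact. -/
theorem stmt13 {X : Type u} [TopologicalSpace X] [T35Space X]
    [FirstCountableTopology X] [SeqCompactSpace X]
    (hrem : ∀ K : Set (StoneCech X),
      K ⊆ (Set.range (stoneCechUnit : X → StoneCech X))ᶜ → IsCompact K → K.Finite) :
    SeqCompactSpace (StoneCech X) := by
  refine ⟨fun u _ => ?_⟩
  by_cases hX : ∃ᶠ n in atTop, u n ∈ range (stoneCechUnit : X → StoneCech X)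
  · obtain ⟨φ, hφ, h⟩ := extraction_of_frequently_atTop hX
    choose v hv using h
    obtain ⟨x, ψ, hψ, hx⟩ := SeqCompactSpace.tendsto_subseq v
    refine ⟨stoneCechUnit x, mem_univ _, φ ∘ ψ, hφ.comp hψ, ?_⟩
    convert (continuous_stoneCechUnit.tendsto x).comp hx using 1
    ext n
    exact (hv (ψ n)).symm
  obtain ⟨φ, hφ, h⟩ := extraction_of_eventually_atTop (not_frequently.1 hX)
  by_cases hc : ∃ x : X, MapClusterPt (stoneCechUnit x) atTop (u ∘ φ)
  · obtain ⟨x, hx⟩ := hc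
    have := isDenseInducing_stoneCechUnit.isCountablyGenerated_nhds x
    obtain ⟨ψ, hψ, hlim⟩ := subseq_tendsto_of_neBot hx
    exact ⟨_, mem_univ _, φ ∘ ψ, hφ.comp hψ, hlim⟩
  · have hfin : (closure (range (u ∘ φ))).Finite := by
      refine hrem _ ?_ isClosed_closure.isCompact
      rintro _ hy ⟨x, rfl⟩
      refine hc ⟨x, mapClusterPt_of_mem_closure_range_of_notMem hy ?_⟩
      rintro ⟨n, hn⟩
      exact h n ⟨x, hn.symm⟩
    obtain ⟨y, ψ, hψ, hy⟩ :=
      hfin.exists_strictMono_const fun n => subset_closure (mem_range_self n)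
    exact ⟨y, mem_univ _, φ ∘ ψ, hφ.comp hψ, tendsto_const_nhds.congr fun n => (hy n).symm⟩
end

section
/- Let X be a linear order of cardinality ℵ₁ that is an η₁-set: for all countable subsets A, B of X (possibly empty) with a < b for every a ∈ A and b ∈ B, there is an x ∈ X with a < x < b for all a ∈ A, b ∈ B. Then the set of Dedekind cuts of X has cardinality exactly 2^{ℵ₁}; in particular, the Dedekind completion of X has cardinality 2^{ℵ₁}. -/
open Cardinal

section SignExpansion

/-- The points obtained by following the sign expansion `s`: the point at `i` is chosen by `F`
between the earlier points with index in `s` and the earlier points with index outside `s`. -/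
noncomputable def signPoint {X ι : Type*} [LinearOrder ι] [WellFoundedLT ι]
    (F : Set X → Set X → X) (s : Set ι) (i : ι) : X :=
  F (Set.range fun j : {j : ι // j < i ∧ j ∈ s} => signPoint F s j.1)
    (Set.range fun j : {j : ι // j < i ∧ j ∉ s} => signPoint F s j.1)
termination_by (wellFounded_lt (α := ι)).wrap i
decreasing_by all_goals exact j.2.1

variable {X ι : Type*} [LinearOrder ι] [WellFoundedLT ι]

theorem signPoint_congr (F : Set X → Set X → X) {s t : Set ι} (i : ι)
    (h : ∀ j < i, (j ∈ s ↔ j ∈ t)) : signPoint F s i = signPoint F t i := by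
  induction i using WellFoundedLT.induction with
  | ind i ih =>
    have key : ∀ j < i, signPoint F s j = signPoint F t j := fun j hj =>
      ih j hj fun k hk => h k (hk.trans hj)
    rw [signPoint, signPoint]
    congr 1 <;>
    · ext x
      simp only [Set.mem_range, Subtype.exists, exists_prop]
      refine exists_congr fun j => ⟨?_, ?_⟩ <;> rintro ⟨⟨hj, hs⟩, hx⟩ <;>
        have h1 := h j hj <;> have h2 := key j hj <;> grind

variable [LinearOrder X]

theorem signPoint_spec [∀ i : ι, Countable (Set.Iio i)] {F : Set X → Set X → X}
    (hF : ∀ A B : Set X, A.Countable → B.Countable → (∀ a ∈ A, ∀ b ∈ B, a < b) →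
      (∀ a ∈ A, a < F A B) ∧ (∀ b ∈ B, F A B < b)) (s : Set ι) (i : ι) :
    (∀ j < i, j ∈ s → signPoint F s j < signPoint F s i) ∧
      (∀ j < i, j ∉ s → signPoint F s i < signPoint F s j) := by
  induction i using WellFoundedLT.induction with
  | ind i ih =>
    have hcount (p : ι → Prop) : Countable {j : ι // j < i ∧ p j} :=
      ((Set.to_countable (Set.Iio i)).mono fun _ hj => hj.1 :
        {j : ι | j < i ∧ p j}.Countable).to_subtype
    have := hcount (· ∈ s)
    have := hcount (· ∉ s)
    have hspec := hF
      (Set.range fun j : {j : ι // j < i ∧ j ∈ s} => signPoint F s j.1)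
      (Set.range fun j : {j : ι // j < i ∧ j ∉ s} => signPoint F s j.1)
      (Set.countable_range _) (Set.countable_range _) (by
        rintro _ ⟨⟨j, hj, hjs⟩, rfl⟩ _ ⟨⟨k, hk, hks⟩, rfl⟩
        rcases lt_trichotomy j k with h | rfl | h
        · exact (ih k hk).1 j h hjs
        · exact absurd hjs hks
        · exact (ih j hj).2 k h hks)
    rw [← signPoint.eq_def F s i] at hspec
    exact ⟨fun j hj hs => hspec.1 _ ⟨⟨j, hj, hs⟩, rfl⟩,
      fun j hj hs => hspec.2 _ ⟨⟨j, hj, hs⟩, rfl⟩⟩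

theorem lowerClosure_signPoint_injective [∀ i : ι, Countable (Set.Iio i)]
    {F : Set X → Set X → X}
    (hF : ∀ A B : Set X, A.Countable → B.Countable → (∀ a ∈ A, ∀ b ∈ B, a < b) →
      (∀ a ∈ A, a < F A B) ∧ (∀ b ∈ B, F A B < b)) :
    Function.Injective fun s : Set ι => {x : X | ∃ i ∈ s, x ≤ signPoint F s i} := by
  intro s t hst
  ext i
  induction i using WellFoundedLT.induction with
  | ind i ih =>
    have separate : ∀ u v : Set ι, (∀ j < i, (j ∈ u ↔ j ∈ v)) →
        {x : X | ∃ i ∈ u, x ≤ signPoint F u i} = {x : X | ∃ i ∈ v, x ≤ signPoint F v i} →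
        i ∈ u → i ∈ v := by
      intro u v huv heq hu
      by_contra hv
      have hmem : signPoint F u i ∈ {x : X | ∃ i ∈ v, x ≤ signPoint F v i} :=
        heq ▸ ⟨i, hu, le_rfl⟩
      obtain ⟨j, hj, hle⟩ := hmem
      rw [signPoint_congr F i huv] at hle
      rcases lt_trichotomy j i with h | rfl | h
      · exact hle.not_gt ((signPoint_spec hF v i).1 j h hj)
      · exact hv hj
      · exact hle.not_gt ((signPoint_spec hF v j).2 i h hv)
    exact ⟨separate s t ih hst, separate t s (fun j hj => (ih j hj).symm) hst.symm⟩

end SignExpansion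

/-- if `X` is a linear order of cardinality `ℵ₁` which is an `η₁`-set,
then the set of Dedekind cuts (downward-closed subsets) of `X` has cardinality exactly
`2^ℵ₁`. -/
theorem stmt15 {X : Type} [LinearOrder X] (hcard : #X = Cardinal.aleph 1)
    (heta : ∀ A B : Set X, A.Countable → B.Countable →
      (∀ a ∈ A, ∀ b ∈ B, a < b) →
      ∃ x : X, (∀ a ∈ A, a < x) ∧ (∀ b ∈ B, x < b)) :
    #{C : Set X // ∀ a b : X, a ≤ b → b ∈ C → a ∈ C} = 2 ^ Cardinal.aleph 1 := by
  apply le_antisymm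
  · rw [← hcard, ← mk_set]
    exact mk_subtype_le _
  · have hF : ∃ F : Set X → Set X → X, ∀ A B : Set X, A.Countable → B.Countable →
        (∀ a ∈ A, ∀ b ∈ B, a < b) → (∀ a ∈ A, a < F A B) ∧ (∀ b ∈ B, F A B < b) := by
      have : Nonempty X := (heta ∅ ∅ (by simp) (by simp) (by simp)).nonempty
      have : ∀ A B : Set X, ∃ x : X, A.Countable → B.Countable →
          (∀ a ∈ A, ∀ b ∈ B, a < b) → (∀ a ∈ A, a < x) ∧ (∀ b ∈ B, x < b) := by
        intro A B
        by_cases h : A.Countable ∧ B.Countable ∧ ∀ a ∈ A, ∀ b ∈ B, a < b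
        · obtain ⟨x, hx⟩ := heta A B h.1 h.2.1 h.2.2
          exact ⟨x, fun _ _ _ => hx⟩
        · exact ⟨Classical.arbitrary X, fun hA hB hAB => absurd ⟨hA, hB, hAB⟩ h⟩
      choose F hF using this
      exact ⟨F, hF⟩
    obtain ⟨F, hF⟩ := hF
    let ι := (ℵ₁ : Cardinal.{0}).ord.ToType
    have hι : #ι = ℵ₁ := mk_ord_toType _
    have (i : ι) : Countable (Set.Iio i) := by
      rw [← mk_le_aleph0_iff, ← Order.lt_succ_iff, succ_aleph0]
      simpa only [hι] using mk_Iio_lt i (by simp [ι])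
    have hinj := lowerClosure_signPoint_injective (ι := ι) hF
    rw [← hι, ← mk_set]
    refine mk_le_of_injective (f := fun s : Set ι =>
      ⟨{x : X | ∃ i ∈ s, x ≤ signPoint F s i}, ?_⟩) ?_
    · rintro a b hab ⟨i, hi, hb⟩
      exact ⟨i, hi, hab.trans hb⟩
    · intro s t h
      exact hinj (congrArg Subtype.val h)
end
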